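/- Let K ⊂ H⁺(y₀)×X be an invariant set and let (N₁,N₂) be an index pair for (y₀,K). Then there is T̄ ≥ 0 such that for all T ≥ T̄, the set N₂^{−T}(N₁) is a neighborhood of N₂ in the subspace N₁ (i.e. N₂ is contained in the interior of N₂^{−T}(N₁) relative to N₁). -/

import Mathlib

open Filter Topology Set
open scoped NNReal ENNReal

noncomputable section

/-- A partial semiflow on a topological space `Z`. The value `none` plays the role of the
symbol `◊` ("undefined").  Time is modelled by `ℝ≥0`. -/
structure PartialSemiflow (Z : Type*) [TopologicalSpace Z] where
  /-- The (partially defined) flow map. -/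
  flow : ℝ≥0 → Z → Option Z
  /-- The domain of definition is open in `[0,∞) × Z`. -/
  isOpen_dom : IsOpen {p : ℝ≥0 × Z | (flow p.1 p.2).isSome = true}
  /-- The flow is continuous on its domain of definition. -/
  continuous_flow : ∀ V : Set Z, IsOpen V →
    IsOpen {p : ℝ≥0 × Z | ∃ z ∈ V, flow p.1 p.2 = some z}
  /-- `z π 0 = z`. -/
  flow_zero : ∀ z, flow 0 z = some z
  /-- The semigroup property; `◊ π t = ◊` is built into `Option.bind`. -/
  flow_add : ∀ (t₁ t₂ : ℝ≥0) (z : Z), flow (t₁ + t₂) z = (flow t₁ z).bind (flow t₂)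

namespace PartialSemiflow

variable {Z : Type*} [TopologicalSpace Z] (π : PartialSemiflow Z)

/-- `π.mem t z M` means: `z π t` is defined and belongs to `M`. -/
def mem (t : ℝ≥0) (z : Z) (M : Set Z) : Prop := ∃ w ∈ M, π.flow t z = some w

/-- `π.segMem t z M` means `z π [0,t] ⊆ M`. -/
def segMem (t : ℝ≥0) (z : Z) (M : Set Z) : Prop := ∀ s ≤ t, π.mem s z M

/-- A full solution `u : ℝ → Z` of the semiflow. -/
def IsSolution (u : ℝ → Z) : Prop :=
  ∀ (t₀ : ℝ) (s : ℝ≥0), π.flow s (u t₀) = some (u (t₀ + (s : ℝ)))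

/-- The largest invariant subset of `N`. -/
def Inv (N : Set Z) : Set Z :=
  {z | ∃ u : ℝ → Z, π.IsSolution u ∧ (∀ t, u t ∈ N) ∧ u 0 = z}

/-- The largest negatively invariant subset of `N` (solutions on `(-∞,0]`). -/
def InvMinus (N : Set Z) : Set Z :=
  {z | ∃ u : ℝ → Z, (∀ t ≤ (0 : ℝ), u t ∈ N) ∧
    (∀ (t₀ : ℝ) (s : ℝ≥0), t₀ + (s : ℝ) ≤ 0 → π.flow s (u t₀) = some (u (t₀ + (s : ℝ)))) ∧
    u 0 = z}

/-- Strong admissibility of a set `M`: asymptotic compactness together with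
non-explosion of the semiflow in `M`. -/
def StronglyAdmissible (M : Set Z) : Prop :=
  (∀ (z : ℕ → Z) (t : ℕ → ℝ≥0),
      (∀ n, π.segMem (t n) (z n) M) →
      ∃ w : ℕ → Z, (∀ n, π.flow (t n) (z n) = some (w n)) ∧
        ∃ φ : ℕ → ℕ, StrictMono φ ∧ ∃ l : Z, Tendsto (w ∘ φ) atTop (nhds l)) ∧
  (∀ (z : Z) (t : ℝ≥0), (∀ s < t, ∃ w ∈ M, π.flow s z = some w) → (π.flow t z).isSome)

end PartialSemiflow

/-- A global (everywhere defined) semiflow on `Y`, the "translation" `y ↦ y^t`. -/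
structure GlobalSemiflow (Y : Type*) [TopologicalSpace Y] where
  /-- The translation map. -/
  trans : ℝ≥0 → Y → Y
  continuous_trans : Continuous fun p : ℝ≥0 × Y => trans p.1 p.2
  trans_zero : ∀ y, trans 0 y = y
  trans_add : ∀ (s t : ℝ≥0) (y : Y), trans (s + t) y = trans t (trans s y)

variable {X Y : Type*} [MetricSpace X] [MetricSpace Y]

/-- `π` is a skew-product semiflow over the translation semiflow `σ`:  whenever
`(y,x) π t` is defined, its first component is `y^t`. -/
def GlobalSemiflow.IsSkewProduct (σ : GlobalSemiflow Y) (π : PartialSemiflow (Y × X)) : Prop :=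
  ∀ (t : ℝ≥0) (y : Y) (x : X) (w : Y × X), π.flow t (y, x) = some w → w.1 = σ.trans t y

/-- The positive hull `H⁺(y₀)` of `y₀`. -/
def hullPlus (σ : GlobalSemiflow Y) (y₀ : Y) : Set Y :=
  closure {y | ∃ t : ℝ≥0, σ.trans t y₀ = y}

/-- The space `H⁺(y₀) × X`, as a subset of `Y × X`. -/
def extSpace (σ : GlobalSemiflow Y) (y₀ : Y) : Set (Y × X) :=
  (hullPlus σ y₀) ×ˢ (Set.univ : Set X)

/-- The map `r = r_{y₀} : [0,∞) × X → H⁺(y₀) × X`, `r(t,x) = (y₀^t, x)`. -/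
def rMap (σ : GlobalSemiflow Y) (y₀ : Y) : ℝ≥0 × X → Y × X :=
  fun p => (σ.trans p.1 y₀, p.2)

/-- The canonical semiflow `χ = χ_{y₀}` on `[0,∞) × X`:
`(t,x) χ s = (t+s, Φ(s, y₀^t, x))`. -/
def chi (σ : GlobalSemiflow Y) (π : PartialSemiflow (Y × X)) (y₀ : Y)
    (s : ℝ≥0) (p : ℝ≥0 × X) : Option (ℝ≥0 × X) :=
  (π.flow s (σ.trans p.1 y₀, p.2)).map fun w => (p.1 + s, w.2)

/-- `chiMem σ π y₀ s p M` means: `p χ s` is defined and belongs to `M`. -/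
def chiMem (σ : GlobalSemiflow Y) (π : PartialSemiflow (Y × X)) (y₀ : Y)
    (s : ℝ≥0) (p : ℝ≥0 × X) (M : Set (ℝ≥0 × X)) : Prop :=
  ∃ q ∈ M, chi σ π y₀ s p = some q

/-- `N` is an isolating neighborhood for `K` in `H⁺(y₀) × X`. -/
def IsIsolatingNbhd (σ : GlobalSemiflow Y) (π : PartialSemiflow (Y × X)) (y₀ : Y)
    (K N : Set (Y × X)) : Prop :=
  N ⊆ extSpace σ y₀ ∧ IsClosed N ∧
  (∀ z ∈ π.Inv N, N ∈ nhdsWithin z (extSpace σ y₀)) ∧ K = π.Inv N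

/-- `W` is a neighborhood of `K` in `H⁺(y₀) × X`. -/
def IsNbhdOfIn (σ : GlobalSemiflow Y) (y₀ : Y) (K W : Set (Y × X)) : Prop :=
  W ⊆ extSpace σ y₀ ∧ ∀ z ∈ K, W ∈ nhdsWithin z (extSpace (X := X) σ y₀)

/-- A basic index pair in `[0,∞) × X` relative to the semiflow `χ_{y₀}`. -/
structure IsBasicIndexPair (σ : GlobalSemiflow Y) (π : PartialSemiflow (Y × X)) (y₀ : Y)
    (N₁ N₂ : Set (ℝ≥0 × X)) : Prop where
  subset : N₂ ⊆ N₁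
  closed₁ : IsClosed N₁
  closed₂ : IsClosed N₂
  ip2 : ∀ p ∈ N₁, ∀ t : ℝ≥0, ¬ chiMem σ π y₀ t p N₁ → ∃ s ≤ t, chiMem σ π y₀ s p N₂
  ip3 : ∀ p ∈ N₂, ∀ t : ℝ≥0, ¬ chiMem σ π y₀ t p N₂ → ∃ s ≤ t, ¬ chiMem σ π y₀ s p N₁

/-- An index pair for `(y₀, K)`. -/
structure IsIndexPair (σ : GlobalSemiflow Y) (π : PartialSemiflow (Y × X)) (y₀ : Y)
    (K : Set (Y × X)) (N₁ N₂ : Set (ℝ≥0 × X)) : Prop where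
  toBasic : IsBasicIndexPair σ π y₀ N₁ N₂
  ip4 : ∃ N : Set (Y × X), IsIsolatingNbhd σ π y₀ K N ∧ π.StronglyAdmissible N ∧
    N₁ \ N₂ ⊆ rMap σ y₀ ⁻¹' N
  ip5 : ∃ W : Set (Y × X), IsNbhdOfIn σ y₀ K W ∧ rMap σ y₀ ⁻¹' W ⊆ N₁ \ N₂

/-- `N₂^{-T}(N₁) = {p ∈ N₁ : p χ s ∈ N₂ for some s ∈ [0,T]}`. -/
def backSet (σ : GlobalSemiflow Y) (π : PartialSemiflow (Y × X)) (y₀ : Y)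
    (N₁ N₂ : Set (ℝ≥0 × X)) (T : ℝ≥0) : Set (ℝ≥0 × X) :=
  {p ∈ N₁ | ∃ s ≤ T, chiMem σ π y₀ s p N₂}


/-- The relation identifying all points of `A ∩ B`, together with an extra point
(which serves as the class `[B]` even when `A ∩ B = ∅`). -/
def quotRel {Z : Type*} (A B : Set Z) : ↥A ⊕ Unit → ↥A ⊕ Unit → Prop
  | Sum.inl a, Sum.inl b => a = b ∨ ((a : Z) ∈ B ∧ (b : Z) ∈ B)
  | Sum.inl a, Sum.inr _ => (a : Z) ∈ B
  | Sum.inr _, Sum.inl b => (b : Z) ∈ B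
  | Sum.inr _, Sum.inr _ => True

/-- The pointed quotient space `A/B`. -/
def PtdQuot {Z : Type*} [TopologicalSpace Z] (A B : Set Z) : Type _ := Quot (quotRel A B)

instance {Z : Type*} [TopologicalSpace Z] (A B : Set Z) : TopologicalSpace (PtdQuot A B) :=
  inferInstanceAs (TopologicalSpace (Quot _))

/-- The base point `[B]` of `A/B`. -/
def PtdQuot.pt {Z : Type*} [TopologicalSpace Z] (A B : Set Z) : PtdQuot A B :=
  Quot.mk _ (Sum.inr ())

/-- `f : (Z, z₀) → (W, w₀)` is a pointed homotopy equivalence. -/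
def IsPointedHomotopyEquiv {Z W : Type*} [TopologicalSpace Z] [TopologicalSpace W]
    (z₀ : Z) (w₀ : W) (f : C(Z, W)) : Prop :=
  f z₀ = w₀ ∧ ∃ g : C(W, Z), g w₀ = z₀ ∧
    Nonempty (ContinuousMap.HomotopyRel (g.comp f) (ContinuousMap.id Z) {z₀}) ∧
    Nonempty (ContinuousMap.HomotopyRel (f.comp g) (ContinuousMap.id W) {w₀})

/-- There is a pointed homotopy equivalence `(Z,z₀) → (W,w₀)`. -/
def PointedHomotopyEquivalent {Z W : Type*} [TopologicalSpace Z] [TopologicalSpace W]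
    (z₀ : Z) (w₀ : W) : Prop :=
  ∃ f : C(Z, W), IsPointedHomotopyEquiv z₀ w₀ f

variable {X Y : Type*} [MetricSpace X] [MetricSpace Y]

/-- `g⁺(z) = sup{t ≥ 0 : z π [0,t] ⊆ U}`, with `sup ∅ = 0`, valued in `[0,∞]`. -/
def gPlus (π : PartialSemiflow (Y × X)) (U : Set (Y × X)) (z : Y × X) : ℝ≥0∞ :=
  ⨆ t ∈ {t : ℝ≥0 | π.segMem t z U}, (t : ℝ≥0∞)

/-- `g⁻(z) = sup{d(z π t, Inv⁻(N)) : t ∈ [0, g⁺(z)], z π t ≠ ◊}`, with `sup ∅ = 0`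
and `d(·,∅) = ∞`, valued in `[0,∞]`. -/
def gMinus (π : PartialSemiflow (Y × X)) (U N : Set (Y × X)) (z : Y × X) : ℝ≥0∞ :=
  ⨆ t ∈ {t : ℝ≥0 | (t : ℝ≥0∞) ≤ gPlus π U z},
    ⨆ w ∈ {w : Y × X | π.flow t z = some w}, EMetric.infEdist w (π.InvMinus N)

/-- The function `f(p) = sup{t₀ ≥ 0 : p χ s ∈ cl(N₁ \ N₂) for all s ∈ [0,t₀]}`,
with `sup ∅ = 0`, valued in `[0,∞]`. -/
def fTime (σ : GlobalSemiflow Y) (π : PartialSemiflow (Y × X)) (y₀ : Y)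
    (N₁ N₂ : Set (ℝ≥0 × X)) (p : ℝ≥0 × X) : ℝ≥0∞ :=
  ⨆ t₀ ∈ {t₀ : ℝ≥0 | ∀ s ≤ t₀, chiMem σ π y₀ s p (closure (N₁ \ N₂))}, (t₀ : ℝ≥0∞)

/-- The α-limit set of a full solution `u`. -/
def solAlphaLimit (u : ℝ → Y × X) : Set (Y × X) := ⋂ t : ℝ, closure (u '' Set.Iic t)

/-- The ω-limit set of a full solution `u`. -/
def solOmegaLimit (u : ℝ → Y × X) : Set (Y × X) := ⋂ t : ℝ, closure (u '' Set.Ici t)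

/-- `(A, R)` is an attractor-repeller decomposition of the isolated invariant set `K`. -/
structure IsARDecomp (σ : GlobalSemiflow Y) (π : PartialSemiflow (Y × X)) (y₀ : Y)
    (K A R : Set (Y × X)) : Prop where
  A_subset : A ⊆ K
  R_subset : R ⊆ K
  disjoint : Disjoint A R
  A_isolated : ∃ N, IsIsolatingNbhd σ π y₀ A N
  R_isolated : ∃ N, IsIsolatingNbhd σ π y₀ R N
  alternatives : ∀ u : ℝ → Y × X, π.IsSolution u → (∀ t, u t ∈ K) →
    (∀ t, u t ∈ A) ∨ (∀ t, u t ∈ R) ∨ (solAlphaLimit u ⊆ R ∧ solOmegaLimit u ⊆ A)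

/-- An index triple for `(y₀, K, A, R)`. -/
structure IsIndexTriple (σ : GlobalSemiflow Y) (π : PartialSemiflow (Y × X)) (y₀ : Y)
    (K A R : Set (Y × X)) (N₁ N₂ N₃ : Set (ℝ≥0 × X)) : Prop where
  sub32 : N₃ ⊆ N₂
  sub21 : N₂ ⊆ N₁
  pairK : IsIndexPair σ π y₀ K N₁ N₃
  pairA : IsIndexPair σ π y₀ A N₂ N₃

/-- An FM-index pair for `K` relative to `π`, restricted to `H⁺(y₀) × X`. -/
structure IsFMIndexPair (σ : GlobalSemiflow Y) (π : PartialSemiflow (Y × X)) (y₀ : Y)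
    (K N₁ N₂ : Set (Y × X)) : Prop where
  subset : N₂ ⊆ N₁
  sub_ext : N₁ ⊆ extSpace σ y₀
  closed₁ : IsClosed N₁
  closed₂ : IsClosed N₂
  isolating : IsIsolatingNbhd σ π y₀ K (closure (N₁ \ N₂))
  interior_K : ∀ z ∈ K, N₁ \ N₂ ∈ nhdsWithin z (extSpace σ y₀)
  posInv : ∀ z ∈ N₂, ∀ t : ℝ≥0, (∀ s ≤ t, π.mem s z N₁) → ∀ s ≤ t, π.mem s z N₂
  exit : ∀ z ∈ N₁, ∀ t : ℝ≥0, ¬ π.mem t z N₁ →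
    ∃ s ≤ t, (∀ s' ≤ s, π.mem s' z N₁) ∧ π.mem s z N₂


namespace PartialSemiflow

section Limits

variable {Z : Type*} [TopologicalSpace Z] {π : PartialSemiflow Z} {ι : Type*} {l : Filter ι}

theorem segMem.mono {s t : ℝ≥0} {z : Z} {M : Set Z} (h : π.segMem t z M) (hst : s ≤ t) :
    π.segMem s z M := fun r hr => h r (hr.trans hst)

/-- The flow at a fixed time is continuous where it is defined. -/
theorem tendsto_of_flow_eq_some {s : ℝ≥0} {z w : ι → Z} {z₀ w₀ : Z}
    (hz : Tendsto z l (𝓝 z₀)) (h₀ : π.flow s z₀ = some w₀)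
    (h : ∀ᶠ i in l, π.flow s (z i) = some (w i)) : Tendsto w l (𝓝 w₀) := by
  refine tendsto_nhds.2 fun V hV hw => ?_
  have hcont : Continuous fun x : Z => (s, x) := by fun_prop
  have hev := hz.eventually
    (((π.continuous_flow V hV).preimage hcont).mem_nhds ⟨w₀, hw, h₀⟩)
  filter_upwards [hev, h] with i hi hi'
  obtain ⟨v, hv, hv'⟩ := hi
  rw [hi', Option.some.injEq] at hv'
  simpa [hv'] using hv

/-- Remaining in a closed set in which the semiflow does not explode is a closed condition. -/
theorem segMem_of_tendsto [l.NeBot] {T : ℝ≥0} {N : Set Z} (hN : IsClosed N)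
    (hexp : ∀ (z : Z) (t : ℝ≥0), (∀ s < t, ∃ w ∈ N, π.flow s z = some w) → (π.flow t z).isSome)
    {z : ι → Z} {z₀ : Z} (hz : Tendsto z l (𝓝 z₀)) (h : ∀ᶠ i in l, π.segMem T (z i) N) :
    π.segMem T z₀ N := by
  have hmem : ∀ s ≤ T, (π.flow s z₀).isSome → π.mem s z₀ N := by
    intro s hs hdef
    obtain ⟨w₀, hw₀⟩ := Option.isSome_iff_exists.1 hdef
    have hw : ∀ᶠ i in l, π.flow s (z i) = some ((π.flow s (z i)).getD (z i)) ∧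
        (π.flow s (z i)).getD (z i) ∈ N := by
      filter_upwards [h] with i hi
      obtain ⟨w, hw, hw'⟩ := hi s hs
      simp [hw', hw]
    exact ⟨w₀, hN.mem_of_tendsto
      (tendsto_of_flow_eq_some hz hw₀ (hw.mono fun _ hi => hi.1)) (hw.mono fun _ hi => hi.2), hw₀⟩
  by_contra hcon
  simp only [segMem, not_forall] at hcon
  obtain ⟨t, htT, ht⟩ := hcon
  let D : Set ℝ≥0 := {s | ¬ (π.flow s z₀).isSome = true}
  have hDc : IsClosed D := by
    have hcont : Continuous fun s : ℝ≥0 => (s, z₀) := by fun_prop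
    exact (π.isOpen_dom.preimage hcont).isClosed_compl
  have htD : t ∈ D := fun h' => ht (hmem t htT h')
  have hinf : sInf D ∈ D := hDc.csInf_mem ⟨t, htD⟩ (OrderBot.bddBelow D)
  refine hinf (hexp z₀ _ fun s hs => ?_)
  refine hmem s (hs.le.trans ((csInf_le (OrderBot.bddBelow D) htD).trans htT)) ?_
  by_contra hs'
  exact (csInf_le (OrderBot.bddBelow D) hs').not_gt hs

end Limits

/-- A strongly admissible closed set in a metric space is compact. -/
theorem StronglyAdmissible.isCompact {Z : Type*} [MetricSpace Z] {π : PartialSemiflow Z}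
    {N : Set Z} (h : π.StronglyAdmissible N) (hN : IsClosed N) : IsCompact N := by
  refine IsSeqCompact.isCompact fun z hz => ?_
  obtain ⟨w, hw, φ, hφ, a, ha⟩ := h.1 z (fun _ => 0) (fun n s hs => by
    obtain rfl : s = 0 := le_antisymm hs (zero_le)
    exact ⟨z n, hz n, π.flow_zero _⟩)
  obtain rfl : z = w := funext fun n => by simpa [π.flow_zero] using hw n
  exact ⟨a, hN.mem_of_tendsto ha (Eventually.of_forall fun n => hz _), φ, hφ, ha⟩

/-- Midpoints of ever longer orbit segments in a strongly admissible closed set accumulate at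
the invariant part of that set. -/
theorem exists_ultrafilter_tendsto_mem_Inv {Z : Type*} [MetricSpace Z] {π : PartialSemiflow Z}
    {N : Set Z} (hadm : π.StronglyAdmissible N) (hN : IsClosed N) {z m : ℕ → Z}
    (hz : ∀ n : ℕ, π.segMem (2 * n) (z n) N) (hm : ∀ n : ℕ, π.flow n (z n) = some (m n)) :
    ∃ (U : Ultrafilter ℕ), ∃ a ∈ π.Inv N, Tendsto m U (𝓝 a) := by
  let U : Ultrafilter ℕ := hyperfilter ℕ
  have hU : (U : Filter ℕ) ≤ atTop := by
    rw [← Nat.cofinite_eq_atTop]; exact hyperfilter_le_cofinite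
  let v : ℝ → ℕ → Z := fun τ n => (π.flow ((n : ℝ) + τ).toNNReal (z n)).getD (z n)
  have hv : ∀ (τ : ℝ) (n : ℕ), |τ| ≤ n →
      π.flow ((n : ℝ) + τ).toNNReal (z n) = some (v τ n) ∧ v τ n ∈ N := by
    intro τ n hn
    have hle : ((n : ℝ) + τ).toNNReal ≤ 2 * n := by
      rw [Real.toNNReal_le_iff_le_coe]
      push_cast
      linarith [le_abs_self τ]
    obtain ⟨w, hw, hw'⟩ := hz n _ hle
    simp [v, hw', hw]
  have hlarge : ∀ τ : ℝ, ∀ᶠ n : ℕ in U, |τ| ≤ n := fun τ =>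
    hU (tendsto_natCast_atTop_atTop.eventually_ge_atTop |τ|)
  have hlim : ∀ τ, ∃ a ∈ N, Tendsto (v τ) U (𝓝 a) := fun τ =>
    (hadm.isCompact hN).ultrafilter_le_nhds (U.map (v τ)) <| by
      rw [le_principal_iff]
      exact (hlarge τ).mono fun n hn => (hv τ n hn).2
  choose u huN hu using hlim
  have hadd : ∀ (t₀ : ℝ) (s : ℝ≥0) (n : ℕ), |t₀| ≤ n → |t₀ + s| ≤ n →
      π.flow s (v t₀ n) = some (v (t₀ + s) n) := by
    intro t₀ s n h₁ h₂
    have h := (hv _ n h₂).1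
    have hsum : ((n : ℝ) + (t₀ + s)).toNNReal = ((n : ℝ) + t₀).toNNReal + s := by
      rw [← add_assoc, Real.toNNReal_add (by linarith [neg_abs_le t₀]) s.coe_nonneg, Real.toNNReal_coe]
    rw [hsum, π.flow_add, (hv _ n h₁).1] at h
    exact h
  have hsol : π.IsSolution u := by
    intro t₀ s
    have hseg : π.segMem s (u t₀) N := by
      refine segMem_of_tendsto hN hadm.2 (hu t₀) ?_
      filter_upwards [hlarge (|t₀| + s)] with n hn r hr
      have hn' : |t₀| + s ≤ (n : ℝ) := (le_abs_self _).trans hn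
      have hr' : (r : ℝ) ≤ s := hr
      have h₂ : |t₀ + r| ≤ n := by
        refine (abs_add_le _ _).trans ?_
        rw [abs_of_nonneg r.coe_nonneg]
        linarith
      exact ⟨_, (hv _ n h₂).2, hadd t₀ r n (by linarith [s.coe_nonneg]) h₂⟩
    obtain ⟨w, -, hw⟩ := hseg s le_rfl
    rw [hw, tendsto_nhds_unique (tendsto_of_flow_eq_some (hu t₀) hw ?_) (hu (t₀ + s))]
    filter_upwards [hlarge t₀, hlarge (t₀ + s)] with n h₁ h₂ using hadd t₀ s n h₁ h₂
  refine ⟨U, u 0, ⟨u, hsol, huN, rfl⟩, ?_⟩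
  have hvm : v 0 = m := by
    funext n
    simp [v, hm n]
  exact hvm ▸ hu 0

end PartialSemiflow

theorem continuous_rMap (σ : GlobalSemiflow Y) (y₀ : Y) :
    Continuous (rMap (X := X) σ y₀) := by
  have h := σ.continuous_trans
  exact (h.comp (continuous_fst.prodMk continuous_const)).prodMk continuous_snd

/-- The map `r` carries orbits of `χ` to orbits of `π`. -/
theorem GlobalSemiflow.IsSkewProduct.chi_eq_some_iff {σ : GlobalSemiflow Y}
    {π : PartialSemiflow (Y × X)} (h : σ.IsSkewProduct π) (y₀ : Y) (s : ℝ≥0) (p q : ℝ≥0 × X) :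
    chi σ π y₀ s p = some q ↔ q.1 = p.1 + s ∧ π.flow s (rMap σ y₀ p) = some (rMap σ y₀ q) := by
  obtain ⟨a, x⟩ := q
  simp only [chi, rMap, Option.map_eq_some_iff, Prod.mk.injEq]
  constructor
  · rintro ⟨⟨y, x'⟩, hw, rfl, rfl⟩
    refine ⟨rfl, ?_⟩
    rw [hw, σ.trans_add, ← h _ _ _ _ hw]
  · rintro ⟨rfl, hw⟩
    exact ⟨_, hw, rfl, rfl⟩

/-- If `N₂^{-T}(N₁)` is not a neighborhood of `p ∈ N₂` in `N₁`, then the orbit of `p` stays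
in `N₂` up to time `T`. -/
theorem stays_of_backSet_notMem_nhdsWithin {σ : GlobalSemiflow Y} {π : PartialSemiflow (Y × X)}
    (hσπ : σ.IsSkewProduct π) {y₀ : Y} {N₁ N₂ : Set (ℝ≥0 × X)}
    (hI : IsBasicIndexPair σ π y₀ N₁ N₂) {N : Set (Y × X)} (hN : IsClosed N)
    (hadm : π.StronglyAdmissible N) (hsub : N₁ \ N₂ ⊆ rMap σ y₀ ⁻¹' N) {T : ℝ≥0}
    {p : ℝ≥0 × X} (hp : p ∈ N₂) (hnot : backSet σ π y₀ N₁ N₂ T ∉ 𝓝[N₁] p) :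
    π.segMem T (rMap σ y₀ p) N ∧ ∀ s ≤ T, chiMem σ π y₀ s p N₂ := by
  let B := backSet σ π y₀ N₁ N₂ T
  have hne : (𝓝[N₁] p ⊓ 𝓟 Bᶜ).NeBot := by
    rw [neBot_iff, Ne, inf_principal_eq_bot, compl_compl]
    exact hnot
  have hq : ∀ᶠ q in 𝓝[N₁] p ⊓ 𝓟 Bᶜ, ∀ s ≤ T, ∃ q' ∈ N₁ \ N₂, chi σ π y₀ s q = some q' := by
    filter_upwards [mem_inf_of_left self_mem_nhdsWithin, mem_inf_of_right (mem_principal_self _)]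
      with q hq₁ hqB s hs
    have hno : ∀ s ≤ T, ¬ chiMem σ π y₀ s q N₂ := fun s hs h => hqB ⟨hq₁, s, hs, h⟩
    have h₁ : chiMem σ π y₀ s q N₁ := by
      by_contra hc
      obtain ⟨r, hr, hr'⟩ := hI.ip2 q hq₁ s hc
      exact hno r (hr.trans hs) hr'
    obtain ⟨q', hq', he⟩ := h₁
    exact ⟨q', ⟨hq', fun h₂ => hno s hs ⟨q', h₂, he⟩⟩, he⟩
  have hid : Tendsto id (𝓝[N₁] p ⊓ 𝓟 Bᶜ) (𝓝 p) := inf_le_left.trans inf_le_left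
  have hr : Tendsto (rMap σ y₀) (𝓝[N₁] p ⊓ 𝓟 Bᶜ) (𝓝 (rMap σ y₀ p)) :=
    (continuous_rMap σ y₀).continuousAt.tendsto.comp hid
  have hseg : π.segMem T (rMap σ y₀ p) N := by
    refine PartialSemiflow.segMem_of_tendsto hN hadm.2 hr ?_
    filter_upwards [hq] with q hq s hs
    obtain ⟨q', hq', he⟩ := hq s hs
    exact ⟨_, hsub hq', ((hσπ.chi_eq_some_iff y₀ s q q').1 he).2⟩
  refine ⟨hseg, fun t ht => ?_⟩
  by_contra hc
  obtain ⟨s, hs, hs'⟩ := hI.ip3 p hp t hc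
  have hsT := hs.trans ht
  obtain ⟨w, -, hw⟩ := hseg s hsT
  refine hs' ⟨(p.1 + s, w.2), ?_, by simp only [rMap] at hw; simp [chi, hw]⟩
  let f : ℝ≥0 × X → ℝ≥0 × X := fun q => (chi σ π y₀ s q).getD q
  have hf : ∀ᶠ q in 𝓝[N₁] p ⊓ 𝓟 Bᶜ, f q ∈ N₁ ∧ chi σ π y₀ s q = some (f q) := by
    filter_upwards [hq] with q hq
    obtain ⟨q', hq', he⟩ := hq s hsT
    simp [f, he, hq'.1]
  have h₂ : Tendsto (fun q => rMap σ y₀ (f q)) (𝓝[N₁] p ⊓ 𝓟 Bᶜ) (𝓝 w) :=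
    PartialSemiflow.tendsto_of_flow_eq_some hr hw
      (hf.mono fun q hq => ((hσπ.chi_eq_some_iff y₀ s q _).1 hq.2).2)
  have h₁ : Tendsto (fun q : ℝ≥0 × X => q.1 + s) (𝓝[N₁] p ⊓ 𝓟 Bᶜ) (𝓝 (p.1 + s)) :=
    ((continuous_fst.add continuous_const).tendsto p).comp hid
  have hlim := h₁.prodMk_nhds ((continuous_snd.tendsto w).comp h₂)
  refine hI.closed₁.mem_of_tendsto hlim ?_
  filter_upwards [hf] with q hq
  have h := ((hσπ.chi_eq_some_iff y₀ s q _).1 hq.2).1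
  rw [← h]
  exact hq.1

theorem statement_17 (σ : GlobalSemiflow Y) (π : PartialSemiflow (Y × X)) (hσπ : σ.IsSkewProduct π) (y₀ : Y)
    (K : Set (Y × X)) (hKsub : K ⊆ extSpace σ y₀) (hKinv : K = π.Inv K)
    (N₁ N₂ : Set (ℝ≥0 × X)) (hN : IsIndexPair σ π y₀ K N₁ N₂) :
    ∃ Tbar : ℝ≥0, ∀ T : ℝ≥0, Tbar ≤ T →
      ∀ p ∈ N₂, backSet σ π y₀ N₁ N₂ T ∈ nhdsWithin p N₁ := by
  obtain ⟨N, ⟨hNext, hNc, -, hK⟩, hadm, hsub⟩ := hN.ip4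
  obtain ⟨W, ⟨-, hW⟩, hWsub⟩ := hN.ip5
  by_contra! hcon
  choose T hT p hp hnot using fun n : ℕ => hcon (2 * n)
  have hstay := fun n => stays_of_backSet_notMem_nhdsWithin hσπ hN.toBasic hNc hadm hsub
    (hp n) (hnot n)
  have hle : ∀ n : ℕ, (n : ℝ≥0) ≤ 2 * n := fun n => by
    rw [two_mul]; exact le_self_add
  choose q hq hqe using fun n : ℕ => (hstay n).2 n ((hle n).trans (hT n))
  have hflow : ∀ n : ℕ, π.flow n (rMap σ y₀ (p n)) = some (rMap σ y₀ (q n)) := fun n =>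
    ((hσπ.chi_eq_some_iff y₀ n (p n) (q n)).1 (hqe n)).2
  obtain ⟨U, a, ha, hlim⟩ := PartialSemiflow.exists_ultrafilter_tendsto_mem_Inv hadm hNc
    (fun n => (hstay n).1.mono (hT n)) hflow
  have hext : ∀ n, rMap σ y₀ (q n) ∈ extSpace σ y₀ := fun n =>
    ⟨subset_closure ⟨_, rfl⟩, mem_univ _⟩
  have hWev : ∀ᶠ n in U, rMap σ y₀ (q n) ∈ W :=
    (tendsto_nhdsWithin_iff.2 ⟨hlim, Eventually.of_forall hext⟩) (hW a (hK ▸ ha))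
  obtain ⟨n, hn⟩ := hWev.exists
  exact (hWsub hn).2 (hq n)

end
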